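/- The algebra 𝒥 is a commutative Jordan algebra: for all a, b ∈ 𝒥 one has a·b = b·a and (a·b)·(a·a) = a·(b·(a·a)). -/

import Mathlib

set_option maxHeartbeats 1000000
set_option synthInstance.maxHeartbeats 200000

noncomputable section
open scoped TensorProduct

abbrev V2 := ℤ × ℤ

def e1 : V2 := (1, 0)
def e2 : V2 := (0, 1)

/-- `S₀ = 2ℤ²`. -/
def S0 : Set V2 := {ρ | ∃ τ : V2, ρ = 2 • τ}
/-- `S₁ = e₁ + 2ℤ²`. -/
def S1 : Set V2 := {ρ | ∃ τ : V2, ρ = e1 + 2 • τ}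
/-- `S₂ = e₂ + 2ℤ²`. -/
def S2 : Set V2 := {ρ | ∃ τ : V2, ρ = e2 + 2 • τ}
/-- The semilattice `S = S₀ ∪ S₁ ∪ S₂`. -/
def Sset : Set V2 := S0 ∪ S1 ∪ S2

/-- The Jordan algebra `𝒥`, as the free ℂ-vector space on basis `{x^ρ : ρ ∈ S}`. -/
abbrev Jord : Type := ↥Sset →₀ ℂ

open Classical in
/-- `x^ρ` for `ρ ∈ S`, and `0` otherwise. -/
def xJ (ρ : V2) : Jord :=
  if h : ρ ∈ Sset then Finsupp.single ⟨ρ, h⟩ 1 else 0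

/-- The (bilinear) multiplication of `𝒥` : `x^ρ · x^τ = x^{ρ+τ}` if `ρ+τ ∈ S`, else `0`. -/
def mulJ : Jord →ₗ[ℂ] Jord →ₗ[ℂ] Jord :=
  Finsupp.lift (Jord →ₗ[ℂ] Jord) ℂ ↥Sset
    (fun ρ => Finsupp.lift Jord ℂ ↥Sset (fun τ => xJ (ρ.1 + τ.1)))

theorem mem_S0_iff (ρ : V2) : ρ ∈ S0 ↔ ρ.1 % 2 = 0 ∧ ρ.2 % 2 = 0 := by
  obtain ⟨m, n⟩ := ρ
  constructor
  · rintro ⟨⟨p, q⟩, h⟩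
    simp only [Prod.smul_mk, Prod.mk.injEq, nsmul_eq_mul] at h
    push_cast at h
    dsimp only
    omega
  · rintro ⟨h₁, h₂⟩
    refine ⟨(m / 2, n / 2), Prod.ext ?_ ?_⟩ <;> simp at * <;> omega

theorem mem_S1_iff (ρ : V2) : ρ ∈ S1 ↔ ρ.1 % 2 = 1 ∧ ρ.2 % 2 = 0 := by
  obtain ⟨m, n⟩ := ρ
  constructor
  · rintro ⟨⟨p, q⟩, h⟩
    simp only [e1, Prod.smul_mk, Prod.mk_add_mk, Prod.mk.injEq, nsmul_eq_mul] at h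
    push_cast at h
    dsimp only
    omega
  · rintro ⟨h₁, h₂⟩
    refine ⟨(m / 2, n / 2), Prod.ext ?_ ?_⟩ <;> simp [e1] at * <;> omega

theorem mem_S2_iff (ρ : V2) : ρ ∈ S2 ↔ ρ.1 % 2 = 0 ∧ ρ.2 % 2 = 1 := by
  obtain ⟨m, n⟩ := ρ
  constructor
  · rintro ⟨⟨p, q⟩, h⟩
    simp only [e2, Prod.smul_mk, Prod.mk_add_mk, Prod.mk.injEq, nsmul_eq_mul] at h
    push_cast at h
    dsimp only
    omega
  · rintro ⟨h₁, h₂⟩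
    refine ⟨(m / 2, n / 2), Prod.ext ?_ ?_⟩ <;> simp [e2] at * <;> omega

theorem mem_Sset_iff (ρ : V2) : ρ ∈ Sset ↔ ρ ∈ S0 ∨ ρ ∈ S1 ∨ ρ ∈ S2 := by
  simp [Sset, or_assoc]

open Classical in
/-- The part of an element of `𝒥` supported on `T`, inside the group algebra of `ℤ²`. -/
def component (T : Set V2) : Jord →ₗ[ℂ] AddMonoidAlgebra ℂ V2 :=
  Finsupp.lift (AddMonoidAlgebra ℂ V2) ℂ ↥Sset
    (fun ρ => if ρ.1 ∈ T then AddMonoidAlgebra.single ρ.1 1 else 0)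

open Classical in
theorem component_single (T : Set V2) (ρ : ↥Sset) :
    component T (Finsupp.single ρ 1) =
      if ρ.1 ∈ T then AddMonoidAlgebra.single ρ.1 1 else 0 := by
  simp [component]

open Classical in
theorem component_xJ {T : Set V2} (hT : T ⊆ Sset) (ρ : V2) :
    component T (xJ ρ) = if ρ ∈ T then AddMonoidAlgebra.single ρ 1 else 0 := by
  by_cases h : ρ ∈ Sset
  · simp [xJ, h, component_single]
  · simp [xJ, h, mt (@hT ρ) h]

theorem mulJ_single (ρ τ : ↥Sset) :
    mulJ (Finsupp.single ρ 1) (Finsupp.single τ 1) = xJ (ρ.1 + τ.1) := by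
  simp [mulJ]

/-- Bilinear maps on `𝒥` that agree on basis vectors are equal. -/
theorem bilin_ext {M : Type*} [AddCommGroup M] [Module ℂ M] {f g : Jord →ₗ[ℂ] Jord →ₗ[ℂ] M}
    (h : ∀ ρ τ, f (Finsupp.single ρ 1) (Finsupp.single τ 1) =
      g (Finsupp.single ρ 1) (Finsupp.single τ 1)) : f = g := by
  ext ρ τ
  simpa using h ρ τ

theorem component_S0_mulJ (a b : Jord) :
    component S0 (mulJ a b) = component S0 a * component S0 b +
      component S1 a * component S1 b + component S2 a * component S2 b := by
  let m := LinearMap.mul ℂ (AddMonoidAlgebra ℂ V2)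
  have h : mulJ.compr₂ (component S0) = m.compl₁₂ (component S0) (component S0) +
      m.compl₁₂ (component S1) (component S1) + m.compl₁₂ (component S2) (component S2) := by
    refine bilin_ext fun ρ τ => ?_
    have hρ := (mem_Sset_iff _).1 ρ.2
    have hτ := (mem_Sset_iff _).1 τ.2
    simp only [m, LinearMap.compr₂_apply, LinearMap.add_apply, LinearMap.compl₁₂_apply,
      LinearMap.mul_apply', mulJ_single, component_single,
      component_xJ (fun ρ h => (mem_Sset_iff ρ).2 (.inl h))]
    simp only [mem_S0_iff, mem_S1_iff, mem_S2_iff, Prod.fst_add, Prod.snd_add] at *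
    rcases hρ with ⟨h₁, h₂⟩ | ⟨h₁, h₂⟩ | ⟨h₁, h₂⟩ <;>
      rcases hτ with ⟨h₃, h₄⟩ | ⟨h₃, h₄⟩ | ⟨h₃, h₄⟩ <;>
      simp [Int.add_emod, h₁, h₂, h₃, h₄, AddMonoidAlgebra.single_mul_single]
  exact LinearMap.congr_fun₂ h a b

theorem component_S1_mulJ (a b : Jord) :
    component S1 (mulJ a b) =
      component S0 a * component S1 b + component S1 a * component S0 b := by
  let m := LinearMap.mul ℂ (AddMonoidAlgebra ℂ V2)
  have h : mulJ.compr₂ (component S1) = m.compl₁₂ (component S0) (component S1) +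
      m.compl₁₂ (component S1) (component S0) := by
    refine bilin_ext fun ρ τ => ?_
    have hρ := (mem_Sset_iff _).1 ρ.2
    have hτ := (mem_Sset_iff _).1 τ.2
    simp only [m, LinearMap.compr₂_apply, LinearMap.add_apply, LinearMap.compl₁₂_apply,
      LinearMap.mul_apply', mulJ_single, component_single,
      component_xJ (fun ρ h => (mem_Sset_iff ρ).2 (.inr (.inl h)))]
    simp only [mem_S0_iff, mem_S1_iff, mem_S2_iff, Prod.fst_add, Prod.snd_add] at *
    rcases hρ with ⟨h₁, h₂⟩ | ⟨h₁, h₂⟩ | ⟨h₁, h₂⟩ <;>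
      rcases hτ with ⟨h₃, h₄⟩ | ⟨h₃, h₄⟩ | ⟨h₃, h₄⟩ <;>
      simp [Int.add_emod, h₁, h₂, h₃, h₄, AddMonoidAlgebra.single_mul_single]
  exact LinearMap.congr_fun₂ h a b

theorem component_S2_mulJ (a b : Jord) :
    component S2 (mulJ a b) =
      component S0 a * component S2 b + component S2 a * component S0 b := by
  let m := LinearMap.mul ℂ (AddMonoidAlgebra ℂ V2)
  have h : mulJ.compr₂ (component S2) = m.compl₁₂ (component S0) (component S2) +
      m.compl₁₂ (component S2) (component S0) := by
    refine bilin_ext fun ρ τ => ?_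
    have hρ := (mem_Sset_iff _).1 ρ.2
    have hτ := (mem_Sset_iff _).1 τ.2
    simp only [m, LinearMap.compr₂_apply, LinearMap.add_apply, LinearMap.compl₁₂_apply,
      LinearMap.mul_apply', mulJ_single, component_single,
      component_xJ (fun ρ h => (mem_Sset_iff ρ).2 (.inr (.inr h)))]
    simp only [mem_S0_iff, mem_S1_iff, mem_S2_iff, Prod.fst_add, Prod.snd_add] at *
    rcases hρ with ⟨h₁, h₂⟩ | ⟨h₁, h₂⟩ | ⟨h₁, h₂⟩ <;>
      rcases hτ with ⟨h₃, h₄⟩ | ⟨h₃, h₄⟩ | ⟨h₃, h₄⟩ <;>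
      simp [Int.add_emod, h₁, h₂, h₃, h₄, AddMonoidAlgebra.single_mul_single]
  exact LinearMap.congr_fun₂ h a b

theorem coeff_component_Sset (a : Jord) (ρ : ↥Sset) : (component Sset a).coeff ρ.1 = a ρ := by
  induction a using Finsupp.induction_linear with
  | zero => simp
  | add a b ha hb => simp [ha, hb]
  | single τ c =>
    rw [← mul_one c, ← smul_eq_mul, ← Finsupp.smul_single, map_smul, component_single]
    simp [Finsupp.single_apply, Subtype.ext_iff]

theorem component_Sset (a : Jord) :
    component Sset a = component S0 a + component S1 a + component S2 a := by
  have h : component Sset = component S0 + component S1 + component S2 := by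
    refine Finsupp.lhom_ext' fun ρ => LinearMap.ext_ring ?_
    have hρ := ρ.2
    simp only [LinearMap.comp_apply, Finsupp.lsingle_apply, LinearMap.add_apply,
      component_single]
    simp only [mem_Sset_iff, mem_S0_iff, mem_S1_iff, mem_S2_iff] at *
    rcases hρ with ⟨h₁, h₂⟩ | ⟨h₁, h₂⟩ | ⟨h₁, h₂⟩ <;> simp [h₁, h₂]
  exact LinearMap.congr_fun h a

theorem jord_ext {a b : Jord} (h₀ : component S0 a = component S0 b)
    (h₁ : component S1 a = component S1 b) (h₂ : component S2 a = component S2 b) : a = b := by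
  ext ρ
  rw [← coeff_component_Sset, ← coeff_component_Sset, component_Sset, component_Sset, h₀, h₁, h₂]

/-- `𝒥` is a commutative Jordan algebra: `a·b = b·a` and
`(a·b)·(a·a) = a·(b·(a·a))` for all `a, b ∈ 𝒥`. -/
theorem Jord_is_commutative_jordan_algebra :
    ∀ a b : Jord,
      mulJ a b = mulJ b a ∧
      mulJ (mulJ a b) (mulJ a a) = mulJ a (mulJ b (mulJ a a)) := by
  intro a b
  constructor <;> apply jord_ext <;>
    simp only [component_S0_mulJ, component_S1_mulJ, component_S2_mulJ] <;> ring
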